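/- Fix N ∈ ℕ, signs α, β ∈ {−1, 1}, and a smooth function M : (Fin N → ℝ) → (0, ∞). Let Ω ⊆ ℝ × ℝ × (Fin N → ℝ) be open (points written (Ũ, Ṽ, o)) and let R̃ : Ω → (0, ∞) be smooth with R̃ ≠ 2M(o) on Ω and satisfying (R̃/(2M(o)) − 1) · exp(R̃/(2M(o))) = αβ · exp( (−αŨ + βṼ)/(4M(o)) ) on Ω. Define Ã := αβ(1 − 2M(o)/R̃). Then the functions F̃ := 0, G̃ := 0 and H̃_i := −((αŨ + βṼ)/2) · ∂_{o_i} M (i ∈ Fin N) solve system (S) for (Ã, R̃) on Ω; equivalently, the right-hand sides of the three equations of system (S) evaluate on Ω to 0, −(α/2)∂_{o_i}M and −(β/2)∂_{o_i}M respectively. -/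

import Mathlib

noncomputable section

/-- Points `(Ũ, Ṽ, o)` with `o = (o¹, …, o^N)` the Dirac observables. -/
abbrev Pt (N : ℕ) := ℝ × ℝ × (Fin N → ℝ)

/-- The direction of the coordinate `Ũ`. -/
def dU (N : ℕ) : Pt N := (1, 0, 0)

/-- The direction of the coordinate `Ṽ`. -/
def dV (N : ℕ) : Pt N := (0, 1, 0)

/-- The direction of the observable `o^i`. -/
def dO (N : ℕ) (i : Fin N) : Pt N := (0, 0, Pi.single i 1)

/-- Partial derivative of `f` in the direction `d` at `p`. -/
def pd {N : ℕ} (d : Pt N) (f : Pt N → ℝ) (p : Pt N) : ℝ := fderiv ℝ f p d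

/-- System (S) of the paper (Eqs. (6,5)–(6,7)) on a domain `Ω`. -/
def SolvesSOn (N : ℕ) (Ω : Set (Pt N)) (A R F G : Pt N → ℝ)
    (H : Fin N → Pt N → ℝ) : Prop :=
  ∀ (i : Fin N), ∀ p ∈ Ω,
    (pd (dV N) F p - pd (dU N) G p
      = R p / (2 * A p) * (2 * A p * pd (dU N) (pd (dV N) R) p
          - pd (dU N) A p * pd (dV N) R p - pd (dV N) A p * pd (dU N) R p)) ∧
    (pd (dU N) (H i) p - pd (dO N i) F p
      = -(R p / (2 * A p)) * (2 * A p * pd (dO N i) (pd (dU N) R) p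
          - pd (dO N i) A p * pd (dU N) R p - pd (dU N) A p * pd (dO N i) R p)) ∧
    (pd (dV N) (H i) p - pd (dO N i) G p
      = R p / (2 * A p) * (2 * A p * pd (dO N i) (pd (dV N) R) p
          - pd (dO N i) A p * pd (dV N) R p - pd (dV N) A p * pd (dO N i) R p))

theorem hasDerivAt_pd {N : ℕ} {f : Pt N → ℝ} {p : Pt N} (hf : DifferentiableAt ℝ f p)
    (d : Pt N) : HasDerivAt (fun t : ℝ => f (p + t • d)) (pd d f p) 0 :=
  hf.hasFDerivAt.hasLineDerivAt d

theorem pd_congr {N : ℕ} {f g : Pt N → ℝ} {p : Pt N} {Ω : Set (Pt N)} (hΩ : IsOpen Ω)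
    (hp : p ∈ Ω) (h : ∀ q ∈ Ω, f q = g q) (d : Pt N) : pd d f p = pd d g p := by
  have hfg : f =ᶠ[nhds p] g := Filter.eventually_of_mem (hΩ.mem_nhds hp) h
  rw [pd, pd, hfg.fderiv_eq]

theorem pd_const_mul {N : ℕ} {f : Pt N → ℝ} {p : Pt N} (hf : DifferentiableAt ℝ f p)
    (c : ℝ) (d : Pt N) : pd d (fun q => c * f q) p = c * pd d f p := by
  simp [pd, fderiv_const_mul hf]

theorem hasDerivAt_line_comp_snd_snd {N : ℕ} {f : (Fin N → ℝ) → ℝ} {p : Pt N}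
    (hf : DifferentiableAt ℝ f p.2.2) (d : Pt N) :
    HasDerivAt (fun t : ℝ => f (p + t • d).2.2) (fderiv ℝ f p.2.2 d.2.2) 0 :=
  hf.hasFDerivAt.hasLineDerivAt d.2.2

/-- Directional derivatives of the radius function defined by the implicit relation. -/
theorem pd_radius {N : ℕ} {α β : ℝ} {M : (Fin N → ℝ) → ℝ} {Ω : Set (Pt N)} (hΩ : IsOpen Ω)
    {R : Pt N → ℝ} {p : Pt N} (hp : p ∈ Ω) (hM : DifferentiableAt ℝ M p.2.2)
    (hMpos : 0 < M p.2.2) (hR : DifferentiableAt ℝ R p) (hRpos : 0 < R p)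
    (hrel : ∀ p ∈ Ω,
      (R p / (2 * M p.2.2) - 1) * Real.exp (R p / (2 * M p.2.2))
        = α * β * Real.exp ((-(α * p.1) + β * p.2.1) / (4 * M p.2.2)))
    (d : Pt N) :
    pd d R p = R p * fderiv ℝ M p.2.2 d.2.2 / M p.2.2
      + (1 - 2 * M p.2.2 / R p) * ((-(α * d.1) + β * d.2.1) / 2
        - (-(α * p.1) + β * p.2.1) / (2 * M p.2.2) * fderiv ℝ M p.2.2 d.2.2) := by
  have hR' := hasDerivAt_pd hR d
  have hM' := hasDerivAt_line_comp_snd_snd hM d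
  have hU : HasDerivAt (fun t : ℝ => (p + t • d).1) d.1 0 := by
    simpa using ((hasDerivAt_id (0 : ℝ)).mul_const d.1).const_add p.1
  have hV : HasDerivAt (fun t : ℝ => (p + t • d).2.1) d.2.1 0 := by
    simpa using ((hasDerivAt_id (0 : ℝ)).mul_const d.2.1).const_add p.2.1
  have hr := hR'.fun_div (hM'.const_mul 2) (by simpa using hMpos.ne')
  have hx := ((hU.const_mul α).fun_neg.fun_add (hV.const_mul β)).fun_div (hM'.const_mul 4)
    (by simpa using hMpos.ne')
  have hl := (hr.sub_const 1).fun_mul hr.exp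
  have hrhs := hx.exp.const_mul (α * β)
  have hline : Filter.Tendsto (fun t : ℝ => p + t • d) (nhds 0) (nhds p) := by
    have : Continuous (fun t : ℝ => p + t • d) := by fun_prop
    simpa using this.tendsto 0
  have heq := hl.unique (hrhs.congr_of_eventuallyEq
    ((hline.eventually (hΩ.mem_nhds hp)).mono fun t ht => hrel _ ht))
  simp only [zero_smul, add_zero] at heq
  rw [← mul_assoc (α * β), ← hrel p hp] at heq
  have hexp := Real.exp_ne_zero (R p / (2 * M p.2.2))
  generalize Real.exp (R p / (2 * M p.2.2)) = e at heq hexp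
  generalize fderiv ℝ M p.2.2 d.2.2 = M' at heq ⊢
  generalize pd d R p = R' at heq ⊢
  have hM0 := hMpos.ne'
  have hR0 := hRpos.ne'
  generalize M p.2.2 = m at *
  generalize R p = r at *
  field_simp at heq ⊢
  linarith

theorem differentiableAt_one_sub_div {N : ℕ} {M : (Fin N → ℝ) → ℝ} {R : Pt N → ℝ} {p : Pt N}
    (hM : DifferentiableAt ℝ M p.2.2) (hR : DifferentiableAt ℝ R p) (hRp : R p ≠ 0) :
    DifferentiableAt ℝ (fun q : Pt N => 1 - 2 * M q.2.2 / R q) p := by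
  have hM1 : DifferentiableAt ℝ (fun q : Pt N => M q.2.2) p :=
    hM.comp p (f := fun q : Pt N => q.2.2) (by fun_prop)
  fun_prop (disch := assumption)

theorem pd_one_sub_div {N : ℕ} {M : (Fin N → ℝ) → ℝ} {R : Pt N → ℝ} {p : Pt N}
    (hM : DifferentiableAt ℝ M p.2.2) (hR : DifferentiableAt ℝ R p) (hRp : R p ≠ 0)
    (d : Pt N) :
    pd d (fun q => 1 - 2 * M q.2.2 / R q) p
      = -(2 * fderiv ℝ M p.2.2 d.2.2 * R p - 2 * M p.2.2 * pd d R p) / R p ^ 2 := by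
  have h := (((hasDerivAt_line_comp_snd_snd hM d).const_mul 2).fun_div (hasDerivAt_pd hR d)
    (by simpa using hRp)).const_sub 1
  have := (hasDerivAt_pd (differentiableAt_one_sub_div hM hR hRp) d).unique h
  simpa only [neg_div, zero_smul, add_zero] using this

/- STATEMENT 11: For the Eddington–Finkelstein Schwarzschild data `(Ã, R̃)` of
the `(αβ)`-quadrant, the functions `F̃ = 0`, `G̃ = 0`,
`H̃_i = −((αŨ + βṼ)/2) M_{,i}` solve system (S) on `Ω`; equivalently, the
right-hand sides of the three equations of (S) evaluate on `Ω` to `0`,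
`−(α/2) M_{,i}` and `−(β/2) M_{,i}` respectively. -/
theorem stmt_11 (N : ℕ) (α β : ℝ) (hα : α = 1 ∨ α = -1) (hβ : β = 1 ∨ β = -1)
    (M : (Fin N → ℝ) → ℝ) (hM : ContDiff ℝ (⊤ : ℕ∞) M) (hMpos : ∀ o, 0 < M o)
    (Ω : Set (Pt N)) (hΩ : IsOpen Ω)
    (Rt : Pt N → ℝ) (hRt : ContDiffOn ℝ (⊤ : ℕ∞) Rt Ω)
    (hRpos : ∀ p ∈ Ω, 0 < Rt p)
    (hRhor : ∀ p ∈ Ω, Rt p ≠ 2 * M p.2.2)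
    (hrel : ∀ p ∈ Ω,
      (Rt p / (2 * M p.2.2) - 1) * Real.exp (Rt p / (2 * M p.2.2))
        = α * β * Real.exp ((-(α * p.1) + β * p.2.1) / (4 * M p.2.2)))
    (At : Pt N → ℝ)
    (hAdef : ∀ p : Pt N, At p = α * β * (1 - 2 * M p.2.2 / Rt p))
    (Ft Gt : Pt N → ℝ) (Ht : Fin N → Pt N → ℝ)
    (hFdef : ∀ p : Pt N, Ft p = 0) (hGdef : ∀ p : Pt N, Gt p = 0)
    (hHdef : ∀ (i : Fin N) (p : Pt N),
      Ht i p = -((α * p.1 + β * p.2.1) / 2) * fderiv ℝ M p.2.2 (Pi.single i 1)) :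
    SolvesSOn N Ω At Rt Ft Gt Ht ∧
    ∀ (i : Fin N), ∀ p ∈ Ω,
      (Rt p / (2 * At p) * (2 * At p * pd (dU N) (pd (dV N) Rt) p
          - pd (dU N) At p * pd (dV N) Rt p - pd (dV N) At p * pd (dU N) Rt p) = 0) ∧
      (-(Rt p / (2 * At p)) * (2 * At p * pd (dO N i) (pd (dU N) Rt) p
          - pd (dO N i) At p * pd (dU N) Rt p - pd (dU N) At p * pd (dO N i) Rt p)
        = -(α / 2) * fderiv ℝ M p.2.2 (Pi.single i 1)) ∧
      (Rt p / (2 * At p) * (2 * At p * pd (dO N i) (pd (dV N) Rt) p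
          - pd (dO N i) At p * pd (dV N) Rt p - pd (dV N) At p * pd (dO N i) Rt p)
        = -(β / 2) * fderiv ℝ M p.2.2 (Pi.single i 1)) := by
  have hMd : Differentiable ℝ M := hM.differentiable (by simp)
  have hRd : ∀ p ∈ Ω, DifferentiableAt ℝ Rt p := fun p hp =>
    (hRt.contDiffAt (hΩ.mem_nhds hp)).differentiableAt (by simp)
  have hpd : ∀ p ∈ Ω, ∀ d : Pt N, _ := fun p hp d =>
    pd_radius hΩ hp (hMd _) (hMpos _) (hRd p hp) (hRpos p hp) hrel d
  have hf : ∀ p ∈ Ω, ∀ d : Pt N, _ := fun p hp d =>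
    pd_one_sub_div (hMd p.2.2) (hRd p hp) (hRpos p hp).ne' d
  have hfd : ∀ p ∈ Ω, DifferentiableAt ℝ (fun q : Pt N => 1 - 2 * M q.2.2 / Rt q) p :=
    fun p hp => differentiableAt_one_sub_div (hMd p.2.2) (hRd p hp) (hRpos p hp).ne'
  have hRU : ∀ p ∈ Ω, pd (dU N) Rt p = -(α / 2) * (1 - 2 * M p.2.2 / Rt p) := by
    intro p hp
    rw [hpd p hp]
    simp [dU]
    ring
  have hRV : ∀ p ∈ Ω, pd (dV N) Rt p = β / 2 * (1 - 2 * M p.2.2 / Rt p) := by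
    intro p hp
    rw [hpd p hp]
    simp [dV]
    ring
  have hrhs : ∀ (i : Fin N), ∀ p ∈ Ω,
      (Rt p / (2 * At p) * (2 * At p * pd (dU N) (pd (dV N) Rt) p
          - pd (dU N) At p * pd (dV N) Rt p - pd (dV N) At p * pd (dU N) Rt p) = 0) ∧
      (-(Rt p / (2 * At p)) * (2 * At p * pd (dO N i) (pd (dU N) Rt) p
          - pd (dO N i) At p * pd (dU N) Rt p - pd (dU N) At p * pd (dO N i) Rt p)
        = -(α / 2) * fderiv ℝ M p.2.2 (Pi.single i 1)) ∧
      (Rt p / (2 * At p) * (2 * At p * pd (dO N i) (pd (dV N) Rt) p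
          - pd (dO N i) At p * pd (dV N) Rt p - pd (dV N) At p * pd (dO N i) Rt p)
        = -(β / 2) * fderiv ℝ M p.2.2 (Pi.single i 1)) := by
    intro i p hp
    have hα0 : α ≠ 0 := by rcases hα with rfl | rfl <;> norm_num
    have hβ0 : β ≠ 0 := by rcases hβ with rfl | rfl <;> norm_num
    have hA : ∀ d, pd d At p = α * β * pd d (fun q => 1 - 2 * M q.2.2 / Rt q) p := fun d => by
      rw [funext hAdef, pd_const_mul (hfd p hp)]
    have hU2 : ∀ d, pd d (pd (dU N) Rt) p
        = -(α / 2) * pd d (fun q => 1 - 2 * M q.2.2 / Rt q) p := fun d => by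
      rw [pd_congr hΩ hp hRU, pd_const_mul (hfd p hp)]
    have hV2 : ∀ d, pd d (pd (dV N) Rt) p
        = β / 2 * pd d (fun q => 1 - 2 * M q.2.2 / Rt q) p := fun d => by
      rw [pd_congr hΩ hp hRV, pd_const_mul (hfd p hp)]
    have hRO := hpd p hp (dO N i)
    simp only [hA, hU2, hV2, hf p hp, hRU p hp, hRV p hp, hAdef p, hRO]
    have hm0 := (hMpos p.2.2).ne'
    have hr0 := (hRpos p hp).ne'
    have hh : Rt p - 2 * M p.2.2 ≠ 0 := sub_ne_zero.2 (hRhor p hp)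
    simp only [dU, dV, dO, map_zero]
    generalize fderiv ℝ M p.2.2 (Pi.single i 1) = M'
    generalize M p.2.2 = m at *
    generalize Rt p = r at *
    refine ⟨?_, ?_, ?_⟩ <;> field_simp <;> ring
  refine ⟨fun i p hp => ?_, hrhs⟩
  obtain ⟨h1, h2, h3⟩ := hrhs i p hp
  have hF : ∀ d, pd d Ft p = 0 := fun d => by simp [pd, funext hFdef]
  have hG : ∀ d, pd d Gt p = 0 := fun d => by simp [pd, funext hGdef]
  have hdM : DifferentiableAt ℝ (fun o => fderiv ℝ M o (Pi.single i 1)) p.2.2 :=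
    ((hM.fderiv_right (m := (⊤ : ℕ∞)) le_rfl).differentiable
      (by simp) _).clm_apply (by fun_prop)
  have hdM1 : DifferentiableAt ℝ (fun q : Pt N => fderiv ℝ M q.2.2 (Pi.single i 1)) p :=
    hdM.comp p (f := fun q : Pt N => q.2.2) (by fun_prop)
  have hH : ∀ d : Pt N, d.2.2 = 0 → pd d (Ht i) p
      = -((α * d.1 + β * d.2.1) / 2) * fderiv ℝ M p.2.2 (Pi.single i 1) := by
    intro d hd
    have hHd : DifferentiableAt ℝ (Ht i) p := by
      rw [funext (hHdef i)]
      exact DifferentiableAt.fun_mul (by fun_prop) hdM1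
    have h := hasDerivAt_pd hHd d
    have hlin : HasDerivAt (fun t : ℝ => -((α * (p.1 + t * d.1) + β * (p.2.1 + t * d.2.1)) / 2))
        (-((α * d.1 + β * d.2.1) / 2)) 0 := by
      have := (((((hasDerivAt_id (0 : ℝ)).mul_const d.1).const_add p.1).const_mul α).fun_add
        ((((hasDerivAt_id (0 : ℝ)).mul_const d.2.1).const_add p.2.1).const_mul β)).div_const 2
      simpa using this.fun_neg
    refine h.unique ?_
    simpa [hHdef, hd] using hlin.mul_const (fderiv ℝ M p.2.2 (Pi.single i 1))
  rw [h1, h2, h3, hF, hF, hG, hG, hH _ rfl, hH _ rfl]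
  refine ⟨by simp, ?_, ?_⟩ <;> simp [dU, dV]
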